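/- Assume X is reflexive. Let 1 ≤ q < ∞ and let P ⊆ S ⊆ F and R ⊆ G be subspaces such that: R is B-norming for P with some constant c > 0; the closed unit ball of P is compact in the topology τ_B(R); and the closed unit ball of R is compact in the topology τ_B(S). If T : P → P is a (q,R)-summing operator, then T ∘ T is a compact operator (it maps the closed unit ball of P to a relatively norm-compact set). -/

import Mathlib

open scoped BigOperators

noncomputable section

variable {F G X : Type*}
variable [NormedAddCommGroup F] [NormedSpace ℝ F] [CompleteSpace F]
variable [NormedAddCommGroup G] [NormedSpace ℝ G] [CompleteSpace G]
variable [NormedAddCommGroup X] [NormedSpace ℝ X] [CompleteSpace X]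

/-- The closed unit ball of a subspace `R`. -/
def subBall {H : Type*} [NormedAddCommGroup H] [NormedSpace ℝ H] (R : Submodule ℝ H) :
    Set H := {g | g ∈ R ∧ ‖g‖ ≤ 1}

/-- A continuous linear operator `T : P → E` is `(q,R)`-summing with respect to the
continuous bilinear map `B : F × G → X`, with constant `K`. -/
def IsSumming {E : Type*} [NormedAddCommGroup E] [NormedSpace ℝ E]
    (B : F →L[ℝ] G →L[ℝ] X) (P : Submodule ℝ F) (R : Submodule ℝ G)
    (q : ℝ) (T : P →L[ℝ] E) (K : ℝ) : Prop :=
  ∀ (n : ℕ) (f : Fin n → P),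
    (∑ i, ‖T (f i)‖ ^ q) ^ (1 / q) ≤
      K * sSup ((fun g => (∑ i, ‖B (f i : F) g‖ ^ q) ^ (1 / q)) '' subBall R)

/-- `τ_B(S)`: the locally convex topology on `G` generated by the seminorms
`g ↦ ‖B(f,g)‖` for `f ∈ S`. -/
def tauB (B : F →L[ℝ] G →L[ℝ] X) (S : Submodule ℝ F) : TopologicalSpace G :=
  TopologicalSpace.induced (fun g => fun f : S => B (f : F) g) inferInstance

/-- `τ_B(R)`: the locally convex topology on `F` generated by the seminorms
`f ↦ ‖B(f,g)‖` for `g ∈ R`. -/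
def tauB' (B : F →L[ℝ] G →L[ℝ] X) (R : Submodule ℝ G) : TopologicalSpace F :=
  TopologicalSpace.induced (fun f => fun g : R => B f (g : G)) inferInstance

open Set Filter Topology MeasureTheory CompactlySupported

/-- A pointwise compact set of continuous functions on a compact space is sequentially compact
for pointwise convergence. -/
theorem isSeqCompact_of_isCompact_of_continuous {K Y : Type*} [TopologicalSpace K]
    [CompactSpace K] [MetricSpace Y] {C : Set (K → Y)} (hC : IsCompact C)
    (hcont : ∀ f ∈ C, Continuous f) : IsSeqCompact C := by
  intro u hu
  let Φ : K → ℕ → Y := fun g n => u n g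
  have hΦ : Continuous Φ := continuous_pi fun n => hcont _ (hu n)
  obtain ⟨t, htr, htc, htd⟩ :=
    (isCompact_range hΦ).isSeparable.exists_countable_dense_subset
  choose σ hσ using fun y : t => htr y.2
  have := htc.to_subtype
  let D : Set K := range σ
  have : Countable D := (countable_range σ).to_subtype
  let ρ : (K → Y) → D → Y := fun f d => f d
  have hρ : Continuous ρ := continuous_pi fun d => continuous_apply _
  obtain ⟨y, -, φ, hφ, hy⟩ := (hC.image hρ).isSeqCompact fun n => mem_image_of_mem ρ (hu n)
  obtain ⟨x, hxC, hx⟩ :=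
    hC (f := map (u ∘ φ) atTop) (tendsto_principal.mpr (Eventually.of_forall fun n => hu (φ n)))
  have hD : ∀ z, MapClusterPt z atTop (u ∘ φ) → ρ z = y := fun z hz =>
   
    @eq_of_nhds_neBot _ _ _ _ _ ((hz.continuousAt_comp hρ.continuousAt).clusterPt.mono hy)
  have hfib : ∀ z, MapClusterPt z atTop (u ∘ φ) → ∀ g g', Φ g = Φ g' → z g = z g' := by
    intro z hz g g' h
    have hcl : IsClosed {f : K → Y | f g = f g'} :=
      isClosed_eq (continuous_apply g) (continuous_apply g')
    exact hcl.mem_of_mapClusterPt hz (Eventually.of_forall fun n => congrFun h (φ n))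
  refine ⟨x, hxC, φ, hφ, hC.tendsto_nhds_of_unique_mapClusterPt
    (Eventually.of_forall fun n => hu (φ n)) fun z hzC hz => funext fun g => ?_⟩
  have hZ : IsClosed {g | z g = x g} := isClosed_eq (hcont z hzC) (hcont x hxC)
  have htZ : t ⊆ Φ '' {g | z g = x g} := fun p hp =>
    ⟨σ ⟨p, hp⟩,
    congrFun ((hD z hz).trans (hD x hx).symm) (⟨σ ⟨p, hp⟩, mem_range_self _⟩ : D), hσ ⟨p, hp⟩⟩
  obtain ⟨g', hg', hgg'⟩ :=
    closure_minimal htZ (hZ.isCompact.image hΦ).isClosed (htd (mem_range_self g))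
  rw [hfib z hz g g' hgg'.symm, hfib x hx g g' hgg'.symm]
  exact hg'

/-- A uniformly bounded sequence of continuous functions on a compact Hausdorff space which tends
to `0` pointwise has convex combinations that are uniformly small from above. -/
theorem exists_mem_convexHull_lt {K : Type*} [TopologicalSpace K] [CompactSpace K] [T2Space K]
    (v : ℕ → C(K, ℝ)) (M : ℝ) (hM : ∀ n x, ‖v n x‖ ≤ M)
    (hv : ∀ x, Tendsto (fun n => v n x) atTop (𝓝 0)) {δ : ℝ} (hδ : 0 < δ) :
    ∃ w ∈ convexHull ℝ (range v), ∀ x, w x < δ := by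
  by_contra! hcon
  let U : Set C(K, ℝ) := {w | ∀ x, w x < δ}
  have hUo : IsOpen U := by
    convert ContinuousMap.isOpen_setOfPred_mapsTo (X := K) isCompact_univ (isOpen_Iio (a := δ)) using 1
    ext w
    simp [U, MapsTo]
  have hUc : Convex ℝ U := by
    intro a ha b hb s t hs ht hst x
    exact convex_Iio δ (ha x) (hb x) hs ht hst
  have hdisj : Disjoint U (convexHull ℝ (range v)) := by
    rw [Set.disjoint_left]
    intro w hw hw'
    obtain ⟨x, hx⟩ := hcon w hw'
    exact (hw x).not_ge hx
  obtain ⟨Λ, s, hΛU, hΛv⟩ := geometric_hahn_banach_open hUc hUo (convex_convexHull ℝ _) hdisj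
  have hs : 0 < s := by simpa using hΛU 0 fun x => hδ
  have hpos : ∀ w : C(K, ℝ), 0 ≤ w → 0 ≤ Λ w := by
    intro w hw
    by_contra! hneg
    have h := hΛU ((s / Λ w) • w) fun x => by
      have : s / Λ w * w x ≤ 0 :=
        mul_nonpos_of_nonpos_of_nonneg (div_nonpos_of_nonneg_of_nonpos hs.le hneg.le) (hw x)
      simpa using this.trans_lt hδ
    rw [map_smul, smul_eq_mul, div_mul_cancel₀ _ hneg.ne] at h
    exact h.false
  let : MeasurableSpace K := borel K
  have : BorelSpace K := ⟨rfl⟩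
  let L : C_c(K, ℝ) →ₗ[ℝ] ℝ :=
    { toFun := fun f => Λ f.toContinuousMap
      map_add' := fun f g => map_add Λ f.toContinuousMap g.toContinuousMap
      map_smul' := fun r f => map_smul Λ r f.toContinuousMap }
  let L' : C_c(K, ℝ) →ₚ[ℝ] ℝ := PositiveLinearMap.mk₀ L fun f hf => hpos _ hf
  let μ := RealRMK.rieszMeasure L'
  have hint : ∀ n, ∫ x, v n x ∂μ = Λ (v n) := fun n =>
    RealRMK.integral_rieszMeasure L' (CompactlySupportedContinuousMap.continuousMapEquiv (v n))
  have hlim : Tendsto (fun n => ∫ x, v n x ∂μ) atTop (𝓝 (∫ _, (0 : ℝ) ∂μ)) :=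
    tendsto_integral_of_dominated_convergence (fun _ => M)
      (fun n => (v n).continuous.aestronglyMeasurable) (integrable_const M)
      (fun n => ae_of_all _ (hM n)) (ae_of_all _ hv)
  rw [integral_zero] at hlim
  refine hs.not_ge (ge_of_tendsto' hlim fun n => ?_)
  rw [hint]
  exact hΛv _ (subset_convexHull ℝ _ (mem_range_self n))

theorem norm_rpow_smul_rpow {V : Type*} [NormedAddCommGroup V] [NormedSpace ℝ V] {a q : ℝ}
    (ha : 0 ≤ a) (hq : q ≠ 0) (y : V) : ‖(a ^ (1 / q)) • y‖ ^ q = a * ‖y‖ ^ q := by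
  rw [norm_smul, Real.mul_rpow (norm_nonneg _) (norm_nonneg _),
    Real.norm_of_nonneg (by positivity), ← Real.rpow_mul ha, one_div_mul_cancel hq, Real.rpow_one]

theorem IsSumming.sum_fintype_le {E : Type*} [NormedAddCommGroup E] [NormedSpace ℝ E]
    {B : F →L[ℝ] G →L[ℝ] X} {P : Submodule ℝ F} {R : Submodule ℝ G} {q : ℝ} {T : P →L[ℝ] E}
    {K : ℝ} (hT : IsSumming B P R q T K) (hK : 0 ≤ K) (hq : 1 ≤ q) {ι : Type*} [Fintype ι]
    (f : ι → P) {δ : ℝ} (hδ : ∀ g ∈ subBall R, ∑ i, ‖B (f i : F) g‖ ^ q ≤ δ) :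
    (∑ i, ‖T (f i)‖ ^ q) ^ (1 / q) ≤ K * δ ^ (1 / q) := by
  let e := (Fintype.equivFin ι).symm
  have h := hT _ (f ∘ e)
  simp only [Function.comp_apply] at h
  rw [e.sum_comp fun i => ‖T (f i)‖ ^ q] at h
  refine h.trans (mul_le_mul_of_nonneg_left (csSup_le ?_ ?_) hK)
  · exact ⟨_, mem_image_of_mem _ (show (0 : G) ∈ subBall R from ⟨R.zero_mem, by simp⟩)⟩
  · rintro _ ⟨g, hg, rfl⟩
    dsimp only
    rw [e.sum_comp fun i => ‖B (f i : F) g‖ ^ q]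
    exact Real.rpow_le_rpow (Finset.sum_nonneg fun i _ => by positivity) (hδ g hg) (by positivity)

/-- If the unit ball of `R` is `τ_B(S)`-compact, a summing operator sends bounded sequences that
are `τ_B(R)`-null to norm null sequences. -/
theorem IsSumming.tendsto_zero {E : Type*} [NormedAddCommGroup E] [NormedSpace ℝ E]
    {B : F →L[ℝ] G →L[ℝ] X} {P S : Submodule ℝ F} {R : Submodule ℝ G} {q : ℝ} {T : P →L[ℝ] E}
    {K : ℝ} (hT : IsSumming B P R q T K) (hK : 0 ≤ K) (hq : 1 ≤ q) (hPS : P ≤ S)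
    (hRcomp : @IsCompact G (tauB B S) (subBall R)) (u : ℕ → P) {M : ℝ} (hM : ∀ n, ‖u n‖ ≤ M)
    (hu : ∀ g ∈ subBall R, Tendsto (fun n => B (u n : F) g) atTop (𝓝 0)) :
    Tendsto (fun n => T (u n)) atTop (𝓝 0) := by
  have hq0 : 0 < q := zero_lt_one.trans_le hq
  by_contra hnot
  obtain ⟨ε, hε, hfreq⟩ : ∃ ε > 0, ∃ᶠ n in atTop, ε ≤ ‖T (u n)‖ := by
    rw [Metric.tendsto_nhds] at hnot
    push Not at hnot
    simpa using hnot
  obtain ⟨ψ, hψ, hTψ⟩ := extraction_of_frequently_atTop hfreq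
  let J : G → S → X := fun g f => B (f : F) g
  have hJ : IsCompact (J '' subBall R) :=
    @IsCompact.image G _ (tauB B S) _ _ _ hRcomp (@continuous_induced_dom _ _ J _)
  have : CompactSpace (J '' subBall R) := isCompact_iff_compactSpace.mp hJ
  let v : ℕ → C(J '' subBall R, ℝ) := fun n =>
    { toFun := fun k => ‖k.1 ⟨u (ψ n), hPS (u (ψ n)).2⟩‖ ^ q
      continuous_toFun := (((continuous_apply _).comp continuous_subtype_val).norm).rpow_const
        fun _ => Or.inr hq0.le }
  have hM0 : 0 ≤ M := (norm_nonneg _).trans (hM 0)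
  have hvM : ∀ n x, ‖v n x‖ ≤ (‖B‖ * M) ^ q := by
    rintro n ⟨_, g, hg, rfl⟩
    have h1 : ‖B (u (ψ n) : F) g‖ ≤ ‖B‖ * M := by
      calc _ ≤ ‖B‖ * ‖(u (ψ n) : F)‖ * ‖g‖ := B.le_opNorm₂ _ _
        _ ≤ ‖B‖ * M * 1 := by
          gcongr
          · exact hM _
          · exact hg.2
        _ = _ := mul_one _
    change ‖‖B (u (ψ n) : F) g‖ ^ q‖ ≤ _
    rw [Real.norm_of_nonneg (by positivity)]
    exact Real.rpow_le_rpow (norm_nonneg _) h1 hq0.le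
  have hv0 : ∀ x, Tendsto (fun n => v n x) atTop (𝓝 0) := by
    rintro ⟨_, g, hg, rfl⟩
    change Tendsto (fun n => ‖B (u (ψ n) : F) g‖ ^ q) atTop (𝓝 0)
    have h := ((hu g hg).comp hψ.tendsto_atTop).norm.rpow_const (p := q) (Or.inr hq0.le)
    simpa [Real.zero_rpow hq0.ne'] using h
  let η : ℝ := ε / (K + 1)
  have hη : 0 < η := by positivity
  obtain ⟨w, hw, hwlt⟩ := exists_mem_convexHull_lt v _ hvM hv0 (Real.rpow_pos_of_pos hη q)
  obtain ⟨ι, _, a, z, ha0, ha1, hz, rfl⟩ := mem_convexHull_iff_exists_fintype.1 hw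
  choose m hm using hz
  have hsum := hT.sum_fintype_le hK hq (fun i => (a i ^ (1 / q)) • u (ψ (m i))) (δ := η ^ q) <| by
    intro g hg
    have h := (hwlt ⟨J g, mem_image_of_mem J hg⟩).le
    simp only [← hm, ContinuousMap.coe_sum, Finset.sum_apply, ContinuousMap.coe_smul,
      Pi.smul_apply, smul_eq_mul] at h
    have hterm : ∀ i, ‖B (((a i ^ (1 / q)) • u (ψ (m i)) : P) : F) g‖ ^ q
        = a i * ‖B (u (ψ (m i)) : F) g‖ ^ q := by
      intro i
      rw [Submodule.coe_smul, map_smul, smul_apply, norm_rpow_smul_rpow (ha0 i) hq0.ne']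
    simp only [hterm]
    exact h
  have hlow : ε ^ q ≤ ∑ i, ‖T ((a i ^ (1 / q)) • u (ψ (m i)))‖ ^ q := by
    calc ε ^ q = ∑ i, a i * ε ^ q := by rw [← Finset.sum_mul, ha1, one_mul]
      _ ≤ _ := Finset.sum_le_sum fun i _ => by
        rw [map_smul, norm_rpow_smul_rpow (ha0 i) hq0.ne']
        exact mul_le_mul_of_nonneg_left
          (Real.rpow_le_rpow hε.le (hTψ _) hq0.le) (ha0 i)
  have hfin := (Real.rpow_le_rpow (by positivity) hlow (by positivity : 0 ≤ 1 / q)).trans hsum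
  rw [← Real.rpow_mul hε.le, ← Real.rpow_mul hη.le, mul_one_div_cancel hq0.ne', Real.rpow_one,
    Real.rpow_one] at hfin
  have : (K + 1) * η = ε := mul_div_cancel₀ _ (by positivity)
  linarith

/-- A summing operator sends the closed unit ball to a norm compact set. -/
theorem IsSumming.isCompact_image_ball {E : Type*} [NormedAddCommGroup E] [NormedSpace ℝ E]
    {B : F →L[ℝ] G →L[ℝ] X} {P S : Submodule ℝ F} {R : Submodule ℝ G} {q : ℝ} {T : P →L[ℝ] E}
    {K : ℝ} (hT : IsSumming B P R q T K) (hK : 0 ≤ K) (hq : 1 ≤ q) (hPS : P ≤ S)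
    (hPcomp : @IsCompact F (tauB' B R) (subBall P))
    (hRcomp : @IsCompact G (tauB B S) (subBall R)) :
    IsCompact (T '' {f : P | ‖f‖ ≤ 1}) := by
  refine IsSeqCompact.isCompact fun y hy => ?_
  choose f hf hfy using hy
  let J : G → S → X := fun g f => B (f : F) g
  have hJ : IsCompact (J '' subBall R) :=
    @IsCompact.image G _ (tauB B S) _ _ _ hRcomp (@continuous_induced_dom _ _ J _)
  have : CompactSpace (J '' subBall R) := isCompact_iff_compactSpace.mp hJ
  choose γ hγR hγ using fun k : J '' subBall R => k.2
  let I : F → J '' subBall R → X := fun f k => B f (γ k)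
  have hI : @Continuous _ _ (tauB' B R) _ I := by
    let : TopologicalSpace F := tauB' B R
    have hind : Continuous fun (f : F) (g : R) => B f (g : G) := continuous_induced_dom
    exact continuous_pi fun k => continuous_pi_iff.1 hind ⟨γ k, (hγR k).1⟩
  have hC : IsCompact (I '' subBall P) := @IsCompact.image F _ (tauB' B R) _ _ _ hPcomp hI
  have hcont : ∀ φ ∈ I '' subBall P, Continuous φ := by
    rintro _ ⟨p, hp, rfl⟩
    have : I p = fun k => k.1 ⟨p, hPS hp.1⟩ := funext fun k => congrFun (hγ k) ⟨p, hPS hp.1⟩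
    rw [this]
    exact (continuous_apply _).comp continuous_subtype_val
  obtain ⟨_, ⟨h, hh, rfl⟩, φ, hφ, hlim⟩ := isSeqCompact_of_isCompact_of_continuous hC hcont
    fun n => mem_image_of_mem I (show (f n : F) ∈ subBall P from ⟨(f n).2, hf n⟩)
  let h' : P := ⟨h, hh.1⟩
  refine ⟨T h', mem_image_of_mem T hh.2, φ, hφ, ?_⟩
  have key := hT.tendsto_zero hK hq hPS hRcomp (fun n => f (φ n) - h') (M := 2)
    (fun n => (norm_sub_le _ _).trans (by
      have h1 : ‖f (φ n)‖ ≤ 1 := hf _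
      have h2 : ‖h'‖ ≤ 1 := hh.2
      linarith)) (fun g hg => by
      let k : J '' subBall R := ⟨J g, mem_image_of_mem J hg⟩
      have hk : ∀ p ∈ P, B p (γ k) = B p g := fun p hp => congrFun (hγ k) ⟨p, hPS hp⟩
      have h1 : Tendsto (fun n => B (f (φ n) : F) (γ k)) atTop (𝓝 (B h (γ k))) :=
        (tendsto_pi_nhds.1 hlim) k
      simp only [hk _ (f _).2, hk _ hh.1] at h1
      simpa [h'] using h1.sub_const (B h g))
  have : y = fun n => T (f n) := funext fun n => (hfy n).symm
  simpa [this, Function.comp_def] using key.add_const (T h')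

/-- Assume `X` is reflexive, `P ⊆ S ⊆ F`, `R ⊆ G` is `B`-norming for `P` with constant
`c > 0`, the closed unit ball of `P` is `τ_B(R)`-compact and the closed unit ball of `R`
is `τ_B(S)`-compact. If `T : P → P` is `(q,R)`-summing, then `T ∘ T` is a compact
operator: the image of the closed unit ball of `P` under `T ∘ T` is relatively
norm-compact. -/
theorem summing_comp_self_compact (B : F →L[ℝ] G →L[ℝ] X) (P S : Submodule ℝ F)
    (R : Submodule ℝ G) (q : ℝ) (hq : 1 ≤ q) (hPS : P ≤ S)
    (hX : Function.Surjective (NormedSpace.inclusionInDoubleDual ℝ X))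
    (c : ℝ) (hc : 0 < c)
    (hnorm : ∀ f ∈ P, c * ‖f‖ ≤ sSup ((fun g => ‖B f g‖) '' subBall R))
    (hPcomp : @IsCompact F (tauB' B R) (subBall P))
    (hRcomp : @IsCompact G (tauB B S) (subBall R))
    (T : P →L[ℝ] P) (hT : ∃ K, 0 ≤ K ∧ IsSumming B P R q T K) :
    IsCompact (closure ((fun f : P => (T (T f) : F)) '' {f : P | ‖f‖ ≤ 1})) := by
  obtain ⟨K, hK, hT⟩ := hT
  have h := (hT.isCompact_image_ball hK hq hPS hPcomp hRcomp).image
    (continuous_subtype_val.comp T.continuous)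
  rw [image_image] at h
  exact h.closure
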